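/- arXiv:2409.01462 — 4 statements merged into one kernel-verified Lean document; each statement's English description precedes it below -/
import Mathlib

section
/- Let A be an associative unital ring and let I be a radical two-sided ideal of A. If P and P' are finitely generated projective left A-modules and, for some n ≥ 0, there is an A/I-module isomorphism (P/IP) ⊕ (A/I)^n ≅ (P'/IP') ⊕ (A/I)^n, then P ⊕ A^n ≅ P' ⊕ A^n as A-modules. (In other words, the map K₀(A) → K₀(A/I) is injective.) -/
/-- The submodule `I•P` of a left `A`-module `P` generated by the elements `a • p`
with `a ∈ I` and `p ∈ P`. -/
def Ideal.smulSubmodule' {A : Type*} [Ring A] (I : Ideal A)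
    (P : Type*) [AddCommGroup P] [Module A P] : Submodule A P :=
  Submodule.span A {x : P | ∃ a ∈ I, ∃ p : P, x = a • p}

/-- A left ideal all of whose elements are quasi-regular lies in the Jacobson radical. -/
theorem Ideal.le_ring_jacobson_of_quasiRegular {A : Type*} [Ring A] {I : Ideal A}
    (hI : ∀ a ∈ I, ∃ b ∈ I, a + b + a * b = 0) : I ≤ Ring.jacobson A := by
  intro x hx
  rw [← Ideal.jacobson_bot, Ideal.mem_jacobson_iff]
  intro y
  obtain ⟨b, hb, hab⟩ := hI (y * x) (I.mul_mem_left y hx)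
  obtain ⟨c, -, hbc⟩ := hI b hb
  have hright : (1 + y * x) * (1 + b) = 1 := by
    calc _ = 1 + (y * x + b + y * x * b) := by noncomm_ring
      _ = 1 := by rw [hab, add_zero]
  have hright' : (1 + b) * (1 + c) = 1 := by
    calc _ = 1 + (b + c + b * c) := by noncomm_ring
      _ = 1 := by rw [hbc, add_zero]
  have hleft : (1 + b) * (1 + y * x) = 1 := by
    rwa [← left_inv_eq_right_inv hright hright'] at hright'
  refine ⟨1 + b, ?_⟩
  rw [Ideal.mem_bot, sub_eq_zero, mul_assoc, add_comm]
  simpa only [mul_add, mul_one] using hleft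

section

variable {A M N X Y : Type*} [Ring A] [AddCommGroup M] [Module A M] [AddCommGroup N] [Module A N]
  [AddCommGroup X] [Module A X] [AddCommGroup Y] [Module A Y]

theorem Submodule.eq_top_of_sup_jacobson_eq_top [Module.Finite A M] {L : Submodule A M}
    (h : L ⊔ Module.jacobson A M = ⊤) : L = ⊤ := by
  obtain hL | ⟨m, hm, hle⟩ := eq_top_or_exists_le_coatom L
  · exact hL
  · exact absurd (top_le_iff.mp (h ▸ sup_le hle (sInf_le hm))) hm.1

theorem LinearMap.surjective_of_sub_mem_jacobson [Module.Finite A M] (f : M →ₗ[A] M)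
    (hf : ∀ x, x - f x ∈ Module.jacobson A M) : Function.Surjective f := by
  rw [← LinearMap.range_eq_top]
  refine Submodule.eq_top_of_sup_jacobson_eq_top (eq_top_iff.mpr fun x _ => ?_)
  exact Submodule.mem_sup.mpr ⟨f x, ⟨x, rfl⟩, x - f x, hf x, by abel⟩

theorem LinearMap.bijective_of_sub_mem_jacobson [Module.Finite A M] [Module.Projective A M]
    (f : M →ₗ[A] M) (hf : ∀ x, x - f x ∈ Module.jacobson A M) : Function.Bijective f := by
  have hsurj := f.surjective_of_sub_mem_jacobson hf
  obtain ⟨s, hs⟩ := Module.projective_lifting_property f LinearMap.id hsurj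
  have hfs (x : M) : f (s x) = x := LinearMap.congr_fun hs x
  have hs_surj : Function.Surjective s := s.surjective_of_sub_mem_jacobson fun x => by
    rw [← neg_mem_iff, neg_sub]
    simpa only [hfs] using hf (s x)
  exact ⟨(Function.RightInverse.leftInverse_of_surjective hfs hs_surj).injective, hsurj⟩

/-- Isomorphisms lift along projective covers of finitely generated modules. -/
theorem LinearEquiv.nonempty_of_superfluous_ker [Module.Finite A M] [Module.Projective A M]
    [Module.Finite A N] [Module.Projective A N] (p : M →ₗ[A] X) (q : N →ₗ[A] Y)
    (hp : Function.Surjective p) (hq : Function.Surjective q)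
    (hpker : LinearMap.ker p ≤ Module.jacobson A M)
    (hqker : LinearMap.ker q ≤ Module.jacobson A N) (e : X ≃ₗ[A] Y) :
    Nonempty (M ≃ₗ[A] N) := by
  obtain ⟨f, hf⟩ := Module.projective_lifting_property q (e.toLinearMap ∘ₗ p) hq
  obtain ⟨g, hg⟩ := Module.projective_lifting_property p (e.symm.toLinearMap ∘ₗ q) hp
  have hf' (x : M) : q (f x) = e (p x) := LinearMap.congr_fun hf x
  have hg' (y : N) : p (g y) = e.symm (q y) := LinearMap.congr_fun hg y
  have hgf : Function.Bijective (g ∘ₗ f) := LinearMap.bijective_of_sub_mem_jacobson _ fun x =>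
    hpker (by simp [hf', hg'])
  have hfg : Function.Bijective (f ∘ₗ g) := LinearMap.bijective_of_sub_mem_jacobson _ fun y =>
    hqker (by simp [hf', hg'])
  rw [LinearMap.coe_comp] at hgf hfg
  exact ⟨.ofBijective f ⟨hgf.injective.of_comp, hfg.surjective.of_comp⟩⟩

theorem Module.smul_mem_jacobson {I : Ideal A} (hI : I ≤ Ring.jacobson A) {a : A} (ha : a ∈ I)
    (x : M) : a • x ∈ Module.jacobson A M :=
  Ring.jacobson_smul_top_le A M (Submodule.smul_mem_smul (hI ha) Submodule.mem_top)

end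

section

variable {A : Type*} [Ring A] (I : Ideal A) (P : Type*) [AddCommGroup P] [Module A P] (n : ℕ)

/-- The projection `P ⊕ Aⁿ → P/IP ⊕ (A/I)ⁿ`. -/
def Ideal.stableMkQ :
    (P × (Fin n → A)) →ₗ[A] (P ⧸ I.smulSubmodule' P) × (Fin n → A ⧸ (I : Submodule A A)) :=
  (I.smulSubmodule' P).mkQ.prodMap ((Submodule.mkQ (I : Submodule A A)).compLeft (Fin n))

theorem Ideal.stableMkQ_surjective : Function.Surjective (I.stableMkQ P n) :=
  (Submodule.mkQ_surjective _).prodMap (Submodule.mkQ_surjective _).comp_left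

theorem Ideal.ker_stableMkQ_le_jacobson (hI : I ≤ Ring.jacobson A) :
    LinearMap.ker (I.stableMkQ P n) ≤ Module.jacobson A (P × (Fin n → A)) := by
  rintro ⟨x, v⟩ h
  obtain ⟨hx, hv⟩ := Prod.ext_iff.mp (LinearMap.mem_ker.mp h)
  have hx : x ∈ I.smulSubmodule' P := (Submodule.Quotient.mk_eq_zero _).mp hx
  have hv (i : Fin n) : v i ∈ I := (Submodule.Quotient.mk_eq_zero _).mp (congrFun hv i)
  have hxJ : I.smulSubmodule' P ≤
      (Module.jacobson A (P × (Fin n → A))).comap (LinearMap.inl A P (Fin n → A)) := by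
    refine Submodule.span_le.mpr ?_
    rintro _ ⟨a, ha, y, rfl⟩
    simpa using Module.smul_mem_jacobson hI ha (y, (0 : Fin n → A))
  have hvJ : LinearMap.inr A P (Fin n → A) v ∈ Module.jacobson A (P × (Fin n → A)) := by
    rw [pi_eq_sum_univ' v, map_sum]
    refine Submodule.sum_mem _ fun i _ => ?_
    rw [map_smul]
    exact Module.smul_mem_jacobson hI (hv i) _
  simpa using add_mem (Submodule.mem_comap.mp (hxJ hx)) hvJ

end


/-- Let `A` be an associative unital ring and `I` a radical two-sided ideal of `A`.
If `P`, `P'` are finitely generated projective left `A`-modules and for some `n ≥ 0`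
there is an `A/I`-module isomorphism `(P/IP) ⊕ (A/I)ⁿ ≅ (P'/IP') ⊕ (A/I)ⁿ` (the
`A/I`-structures are induced by the `A`-actions, so such an isomorphism is the same
as an `A`-linear one), then `P ⊕ Aⁿ ≅ P' ⊕ Aⁿ` as `A`-modules.  In other words,
`K₀(A) → K₀(A/I)` is injective. -/
theorem stably_iso_of_quotient_stably_iso_of_radical
    {A : Type*} [Ring A] (I : Ideal A)
    (htwosided : ∀ a ∈ I, ∀ r : A, a * r ∈ I)
    (hrad : ∀ a ∈ I, ∃ b ∈ I, a + b + a * b = 0)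
    {P P' : Type*} [AddCommGroup P] [Module A P] [AddCommGroup P'] [Module A P']
    [Module.Finite A P] [Module.Projective A P]
    [Module.Finite A P'] [Module.Projective A P']
    (n : ℕ)
    (h : Nonempty (((P ⧸ I.smulSubmodule' P) × (Fin n → A ⧸ (I : Submodule A A))) ≃ₗ[A]
        ((P' ⧸ I.smulSubmodule' P') × (Fin n → A ⧸ (I : Submodule A A))))) :
    Nonempty ((P × (Fin n → A)) ≃ₗ[A] (P' × (Fin n → A))) := by
  have hI := Ideal.le_ring_jacobson_of_quasiRegular hrad
  obtain ⟨e⟩ := h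
  exact LinearEquiv.nonempty_of_superfluous_ker (I.stableMkQ P n) (I.stableMkQ P' n)
    (I.stableMkQ_surjective P n) (I.stableMkQ_surjective P' n)
    (I.ker_stableMkQ_le_jacobson P n hI) (I.ker_stableMkQ_le_jacobson P' n hI) e
end

section
/- Let S be an infinite profinite set, regarded as a condensed set via S ↦ (T ↦ C(T,S)). Then S admits no discretization: there is no pair (D, u) with D a discrete condensed set and u : S ⟶ D a morphism of condensed sets such that every morphism from S to a discrete condensed set factors uniquely through u. -/
open CategoryTheory

universe u

namespace CondensedSet

/-- The morphism from a profinite set to a discrete condensed set given by a locally constant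
map. -/
noncomputable def ofLocallyConstant {S : Profinite.{u}} {Y : Type (u + 1)}
    (b : LocallyConstant S Y) : S.toCondensed ⟶ LocallyConstant.functor.{u}.obj Y :=
  ⟨{ app := fun T ↦ ↾fun (f : ULift.{u + 1} (T.unop ⟶ profiniteToCompHaus.obj S)) ↦
        (b.comap f.down.hom.hom : LocallyConstant T.unop Y)
     naturality := fun _ _ _ ↦ rfl }⟩

/-- A point of a profinite set, as a section over the one-point space. -/
noncomputable def profinitePoint (S : Profinite.{u}) (x : S) :
    S.toCondensed.obj.obj ⟨CompHaus.of PUnit.{u + 1}⟩ :=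
  (ULift.up ((CompHaus.of PUnit.{u + 1}).const (x : profiniteToCompHaus.obj S)) :
    ULift.{u + 1} (CompHaus.of PUnit.{u + 1} ⟶ profiniteToCompHaus.obj S))

lemma ofLocallyConstant_profinitePoint {S : Profinite.{u}} {Y : Type (u + 1)}
    (b : LocallyConstant S Y) (x : S) :
    (ofLocallyConstant b).hom.app _ (profinitePoint S x) =
      (LocallyConstant.const PUnit.{u + 1} (b x) : LocallyConstant PUnit.{u + 1} Y) :=
  rfl

/-- A morphism from a profinite set to a discrete condensed set is given on points by a locally
constant map. -/
lemma exists_locallyConstant_of_hom {S : Profinite.{u}} {X : Type (u + 1)}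
    (v : S.toCondensed ⟶ LocallyConstant.functor.{u}.obj X) :
    ∃ c : LocallyConstant S X, ∀ x, v.hom.app _ (profinitePoint S x) =
      (LocallyConstant.const PUnit.{u + 1} (c x) : LocallyConstant PUnit.{u + 1} X) := by
  let i : S.toCondensed.obj.obj ⟨profiniteToCompHaus.obj S⟩ :=
    (ULift.up (𝟙 _) : ULift.{u + 1} (profiniteToCompHaus.obj S ⟶ profiniteToCompHaus.obj S))
  refine ⟨(v.hom.app ⟨profiniteToCompHaus.obj S⟩ i : LocallyConstant S X), fun x ↦ ?_⟩
  exact NatTrans.naturality_apply v.hom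
    ((CompHaus.of PUnit.{u + 1}).const (x : profiniteToCompHaus.obj S)).op i

end CondensedSet

/-- A locally constant map on an infinite compact space is not injective. -/
lemma LocallyConstant.exists_ne_apply_eq {S X : Type*} [TopologicalSpace S] [CompactSpace S]
    [Infinite S] (c : LocallyConstant S X) : ∃ x y, x ≠ y ∧ c x = c y := by
  have : Finite (Set.range c) := c.range_finite
  obtain ⟨x, y, hxy, h⟩ := Finite.exists_ne_map_eq_of_infinite (Set.rangeFactorization c)
  exact ⟨x, y, hxy, congrArg Subtype.val h⟩

open CondensedSet in
/-- **An infinite profinite set admits no discretization.**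
Let `S` be an infinite profinite set, regarded as a condensed set via
`T ↦ C(T, S)`.  Then there is no pair `(D, u)` consisting of a discrete condensed
set `D` and a morphism `u : S ⟶ D` such that every morphism from `S` to a discrete
condensed set factors uniquely through `u`. -/
theorem infinite_profinite_no_discretization
    (S : Profinite.{u}) (hS : Infinite S) :
    ¬ ∃ (D : CondensedSet.{u}) (u : S.toCondensed ⟶ D),
        D.IsDiscrete ∧
        ∀ (E : CondensedSet.{u}), E.IsDiscrete → ∀ g : S.toCondensed ⟶ E,
          ∃! h : D ⟶ E, u ≫ h = g := by
  rintro ⟨D, v, hD, hv⟩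
  obtain ⟨X, ⟨e⟩⟩ := ((isDiscrete_tfae D).out 0 3).mp hD
  obtain ⟨c, hc⟩ := exists_locallyConstant_of_hom (v ≫ e.inv)
  obtain ⟨x, y, hxy, hcxy⟩ := c.exists_ne_apply_eq
  obtain ⟨U, hU, hxU, hyU⟩ := exists_isClopen_of_totally_separated hxy
  let b : LocallyConstant S (ULift.{u + 1} ℕ) := (LocallyConstant.charFn ℕ hU).map ULift.up
  obtain ⟨h, hh, -⟩ := hv _ (((isDiscrete_tfae _).out 0 3).mpr
    (LocallyConstant.functor.obj_mem_essImage _)) (ofLocallyConstant b)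
  have hpt (s : S) : (LocallyConstant.const PUnit.{u + 1} (b s) : LocallyConstant _ _) =
      (e.hom ≫ h).hom.app ⟨CompHaus.of PUnit.{u + 1}⟩
        (LocallyConstant.const PUnit.{u + 1} (c s) : LocallyConstant PUnit.{u + 1} X) := by
    rw [← ofLocallyConstant_profinitePoint, ← hc, ← hh]
    have : v ≫ h = (v ≫ e.inv) ≫ (e.hom ≫ h) := by simp
    rw [this]
    rfl
  have hb : b x = b y := by
    have h_const := hpt x
    rw [hcxy, ← hpt y] at h_const
    exact congrArg (fun f : LocallyConstant PUnit.{u + 1} _ ↦ f PUnit.unit) h_const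
  exact hyU ((LocallyConstant.charFn_eq_one ℕ y hU).mp
    ((ULift.up_injective hb).symm.trans ((LocallyConstant.charFn_eq_one ℕ x hU).mpr hxU)))
end

section
/- Let C be a category with finite products, with terminal object T, let I be an object of C, let i₀, i₁ : T ⟶ I be two morphisms, and suppose there is a morphism m : I ⨯ I ⟶ I such that m ∘ ⟨i₀ ∘ !_I, id_I⟩ = i₀ ∘ !_I and m ∘ ⟨i₁ ∘ !_I, id_I⟩ = id_I, where !_I : I ⟶ T is the unique map to the terminal object. Let D be any category and F : Cᵒᵖ ⥤ D a functor. Then the following are equivalent: (1) for every object C of C, F applied to the projection C ⨯ I ⟶ C is an isomorphism; (2) for every object C of C, the two morphisms F(C ⨯ I) ⟶ F(C) obtained by applying F to ⟨id_C, i₀ ∘ !_C⟩ and to ⟨id_C, i₁ ∘ !_C⟩ are equal. -/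
open CategoryTheory Limits

namespace CategoryTheory.Limits

variable {C : Type*} [Category C] [HasTerminal C] [HasBinaryProducts C] {I : C}

/-- The section `X ⟶ X ⨯ I` of the projection determined by a point of `I`. -/
noncomputable abbrev prodSection (X : C) (i : ⊤_ C ⟶ I) : X ⟶ X ⨯ I :=
  prod.lift (𝟙 X) (terminal.from X ≫ i)

/-- The map `(X ⨯ I) ⨯ I ⟶ X ⨯ I`, `((x, s), t) ↦ (x, m (t, s))`. -/
noncomputable abbrev prodContraction (X : C) (m : I ⨯ I ⟶ I) : (X ⨯ I) ⨯ I ⟶ X ⨯ I :=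
  prod.lift (prod.fst ≫ prod.fst) (prod.lift prod.snd (prod.fst ≫ prod.snd) ≫ m)

lemma prodSection_comp_prodContraction (X : C) (i : ⊤_ C ⟶ I) (m : I ⨯ I ⟶ I) :
    prodSection (X ⨯ I) i ≫ prodContraction X m =
      prod.lift prod.fst (prod.snd ≫ prod.lift (terminal.from I ≫ i) (𝟙 I) ≫ m) := by
  have h : prodSection (X ⨯ I) i ≫ prod.lift prod.snd (prod.fst ≫ prod.snd) =
      prod.snd ≫ prod.lift (terminal.from I ≫ i) (𝟙 I) := by
    ext <;> simp [prodSection, prod.lift_fst, prod.lift_snd, prod.lift_fst_assoc]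
  ext
  · simp [prodSection, prodContraction, prod.lift_fst, prod.lift_fst_assoc]
  · simpa only [prodContraction, Category.assoc, prod.lift_snd] using h =≫ m

end CategoryTheory.Limits

/-- Let `C` be a category with a terminal object and binary products, `I` an object
of `C` with two points `i₀ i₁ : ⊤ ⟶ I`, and `m : I ⨯ I ⟶ I` a "multiplication"
satisfying `m ∘ ⟨i₀ ∘ !, id⟩ = i₀ ∘ !` and `m ∘ ⟨i₁ ∘ !, id⟩ = id`.  Then for any
functor `F : Cᵒᵖ ⥤ D` the following are equivalent: (1) `F` inverts all projections
`C ⨯ I ⟶ C`; (2) for every object `C`, `F` identifies the two maps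
`⟨id, i₀ ∘ !⟩, ⟨id, i₁ ∘ !⟩ : C ⟶ C ⨯ I`. -/
theorem homotopy_invariance_iff_endpoints_equal
    {C : Type*} [Category C] [HasTerminal C] [HasBinaryProducts C]
    (I : C) (i₀ i₁ : ⊤_ C ⟶ I) (m : I ⨯ I ⟶ I)
    (hm₀ : prod.lift (terminal.from I ≫ i₀) (𝟙 I) ≫ m = terminal.from I ≫ i₀)
    (hm₁ : prod.lift (terminal.from I ≫ i₁) (𝟙 I) ≫ m = 𝟙 I)
    {D : Type*} [Category D] (F : Cᵒᵖ ⥤ D) :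
    (∀ X : C, IsIso (F.map (prod.fst : X ⨯ I ⟶ X).op)) ↔
      (∀ X : C, F.map (prod.lift (𝟙 X) (terminal.from X ≫ i₀)).op =
        F.map (prod.lift (𝟙 X) (terminal.from X ≫ i₁)).op) := by
  constructor
  · intro h X
    have := h X
    rw [← cancel_epi (F.map (prod.fst : X ⨯ I ⟶ X).op)]
    simp only [← F.map_comp, ← op_comp, prod.lift_fst]
  · intro h X
    have h₀ : prodSection (X ⨯ I) i₀ ≫ prodContraction X m = prod.fst ≫ prodSection X i₀ := by
      rw [prodSection_comp_prodContraction, hm₀]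
      ext <;> simp
    have h₁ : prodSection (X ⨯ I) i₁ ≫ prodContraction X m = 𝟙 (X ⨯ I) := by
      rw [prodSection_comp_prodContraction, hm₁]
      ext <;> simp
    refine ⟨F.map (prodSection X i₀).op, ?_, ?_⟩
    · rw [← F.map_comp, ← op_comp, prod.lift_fst, op_id, F.map_id]
    · rw [← F.map_comp, ← op_comp, ← h₀, op_comp, F.map_comp, h, ← F.map_comp, ← op_comp,
        h₁, op_id, F.map_id]
end

section
/- Let A be a real Banach algebra. Let X and X' be compact Hausdorff spaces, φ : X' → X a continuous map, Z ⊆ X a closed subset and Z' = φ⁻¹(Z), and assume φ restricts to a bijection from X' ∖ Z' onto X ∖ Z. Then precomposition with φ, f ↦ f ∘ φ, is a bijection from {f ∈ C(X;A) : f vanishes on Z} onto {g ∈ C(X';A) : g vanishes on Z'}; moreover it is an isomorphism of non-unital rings (it is additive and multiplicative). -/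
/-- If a continuous closed map `φ : X' → X` is bijective over the complement of a closed set `Z`,
every continuous function on `X'` vanishing on `φ ⁻¹' Z` descends to a continuous function on `X`
vanishing on `Z`. -/
theorem ContinuousMap.exists_comp_eq_of_bijOn_compl {X X' B : Type*} [TopologicalSpace X]
    [TopologicalSpace X'] [TopologicalSpace B] [Zero B] (φ : C(X', X)) (hcl : IsClosedMap φ)
    {Z : Set X} (hZ : IsClosed Z) (hφ : Set.BijOn φ (φ ⁻¹' Z)ᶜ Zᶜ) (g : C(X', B))
    (hg : ∀ z ∈ φ ⁻¹' Z, g z = 0) :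
    ∃ f : C(X, B), (∀ z ∈ Z, f z = 0) ∧ f.comp φ = g := by
  have hval : ∀ x, ∃ b, (x ∈ Z → b = 0) ∧ ∀ y, φ y = x → g y = b := by
    intro x
    by_cases hx : x ∈ Z
    · exact ⟨0, fun _ => rfl, fun y hy => hg y (by simpa [hy] using hx)⟩
    · obtain ⟨y, hy, rfl⟩ := hφ.surjOn hx
      refine ⟨g y, fun h => absurd h hx, fun y' hy' => ?_⟩
      have hy'Z : y' ∈ (φ ⁻¹' Z)ᶜ := by simpa [hy'] using hx
      rw [hφ.injOn hy'Z hy hy']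
  choose f hfZ hfg using hval
  have hf : Continuous f := by
    rw [continuous_iff_isClosed]
    intro C hC
    have hpre : f ⁻¹' C = φ '' (g ⁻¹' C) ∪ (Z ∩ {_x | (0 : B) ∈ C}) := by
      ext x
      constructor
      · intro hx
        by_cases hxZ : x ∈ Z
        · exact Or.inr ⟨hxZ, by simpa [hfZ x hxZ] using hx⟩
        · obtain ⟨y, -, rfl⟩ := hφ.surjOn hxZ
          exact Or.inl ⟨y, by simpa [hfg _ y rfl] using hx, rfl⟩
      · rintro (⟨y, hy, rfl⟩ | ⟨hxZ, h0⟩)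
        · simpa [hfg _ y rfl] using hy
        · simpa [hfZ x hxZ] using h0
    rw [hpre]
    exact (hcl _ (hC.preimage g.continuous)).union (hZ.inter isClosed_const)
  exact ⟨⟨f, hf⟩, hfZ, ContinuousMap.ext fun y => (hfg _ y rfl).symm⟩

/-- Let `A` be a real Banach algebra, `X`, `X'` compact Hausdorff spaces,
`φ : X' → X` continuous, `Z ⊆ X` closed with preimage `Z' = φ⁻¹(Z)`, and assume `φ`
restricts to a bijection `X' ∖ Z' ≅ X ∖ Z` (i.e. the square with horizontal closed
embeddings `Z' ↪ X'`, `Z ↪ X` is a blowup square of compacta).  Then `f ↦ f ∘ φ` is a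
bijection from the functions in `C(X; A)` vanishing on `Z` onto the functions in
`C(X'; A)` vanishing on `Z'`; moreover it is additive and multiplicative, hence an
isomorphism of non-unital rings. -/
theorem blowup_square_kernels_isomorphic
    {A : Type*} [NormedRing A] [NormedAlgebra ℝ A] [CompleteSpace A]
    {X X' : Type*} [TopologicalSpace X] [CompactSpace X] [T2Space X]
    [TopologicalSpace X'] [CompactSpace X'] [T2Space X']
    (φ : C(X', X)) (Z : Set X) (hZ : IsClosed Z)
    (hφ : Set.BijOn φ (φ ⁻¹' Z)ᶜ Zᶜ) :
    Function.Bijective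
      (fun f : {f : C(X, A) // ∀ z ∈ Z, f z = 0} =>
        (⟨(f : C(X, A)).comp φ, fun z hz => f.2 (φ z) hz⟩ :
          {g : C(X', A) // ∀ z ∈ φ ⁻¹' Z, g z = 0}))
    ∧ (∀ f g : C(X, A), (f + g).comp φ = f.comp φ + g.comp φ)
    ∧ (∀ f g : C(X, A), (f * g).comp φ = f.comp φ * g.comp φ) := by
  refine ⟨⟨?_, ?_⟩, fun _ _ => rfl, fun _ _ => rfl⟩
  · rintro ⟨f₁, h₁⟩ ⟨f₂, h₂⟩ h
    have hcomp : f₁.comp φ = f₂.comp φ := congrArg Subtype.val h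
    refine Subtype.ext (ContinuousMap.ext fun x => ?_)
    by_cases hx : x ∈ Z
    · exact (h₁ x hx).trans (h₂ x hx).symm
    · obtain ⟨y, -, rfl⟩ := hφ.surjOn hx
      exact DFunLike.congr_fun hcomp y
  · rintro ⟨g, hg⟩
    obtain ⟨f, hfZ, hfg⟩ :=
      φ.exists_comp_eq_of_bijOn_compl φ.continuous.isClosedMap hZ hφ g hg
    exact ⟨⟨f, hfZ⟩, Subtype.ext hfg⟩
end
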